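/- In the overlap array setup, suppose μ satisfies the Ψ-identities for system 1 with the function ψ(x) = x^p for some integer p ≥ 1. If p is even, then μ satisfies the Ψ-identities for system 1 with every even continuous function ψ : [−1,1] → ℝ; if p is odd, then μ satisfies the Ψ-identities for system 1 with every continuous function ψ : [−1,1] → ℝ. -/

import Mathlib

open MeasureTheory

namespace OverlapArray

/-- The space `([-1,1]^{ℕ×ℕ})³` of triples of overlap arrays
`((R¹_{l,l'}), (R²_{l,l'}), (R_{l,l'}))` (realized inside `(ℝ^{ℕ×ℕ})³`, the constraint that
entries lie in `[-1,1]` being imposed almost surely). -/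
abbrev OA : Type := (ℕ → ℕ → ℝ) × (ℕ → ℕ → ℝ) × (ℕ → ℕ → ℝ)

/-- The overlap array `(R¹_{l,l'})` of the first system. -/
def R1 (ω : OA) : ℕ → ℕ → ℝ := ω.1

/-- The overlap array `(R²_{l,l'})` of the second system. -/
def R2 (ω : OA) : ℕ → ℕ → ℝ := ω.2.1

/-- The array `(R_{l,l'})` of cross overlaps. -/
def R (ω : OA) : ℕ → ℕ → ℝ := ω.2.2

/-- Relabelling the replicas of the first system by `π` and of the second system by `π'`. -/
def permMap (π π' : Equiv.Perm ℕ) (ω : OA) : OA :=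
  (fun l l' => R1 ω (π l) (π l'), fun l l' => R2 ω (π' l) (π' l'),
   fun l l' => R ω (π l) (π' l'))

/-- The overlap array setup: `μ` is a probability measure on `OA` with entries a.s. in
`[-1,1]`, `R¹, R²` a.s. symmetric with unit diagonal, and `μ` invariant under finitely
supported permutations of the replicas of each system. -/
structure Setup (μ : Measure OA) : Prop where
  prob : IsProbabilityMeasure μ
  bounded : ∀ᵐ ω ∂μ, ∀ l l', |R1 ω l l'| ≤ 1 ∧ |R2 ω l l'| ≤ 1 ∧ |R ω l l'| ≤ 1
  symm : ∀ᵐ ω ∂μ, ∀ l l', R1 ω l l' = R1 ω l' l ∧ R2 ω l l' = R2 ω l' l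
  diag : ∀ᵐ ω ∂μ, ∀ l, R1 ω l l = 1 ∧ R2 ω l l = 1
  exch : ∀ π π' : Equiv.Perm ℕ, {x | π x ≠ x}.Finite → {x | π' x ≠ x}.Finite →
    μ.map (permMap π π') = μ

/-- Evaluation of a function `f` of the overlaps on the first `n` replicas. -/
def fRep (n : ℕ)
    (f : ((Fin n → Fin n → ℝ) × (Fin n → Fin n → ℝ) × (Fin n → Fin n → ℝ)) → ℝ)
    (ω : OA) : ℝ :=
  f (fun l l' => R1 ω l.val l'.val, fun l l' => R2 ω l.val l'.val,
     fun l l' => R ω l.val l'.val)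

/-- The Ghirlanda–Guerra identities for system 1: for every `n ≥ 1`, every bounded
measurable function `f` of the overlaps on `n` replicas and every bounded Borel even
`ψ : [-1,1] → ℝ`,
`E[f·ψ(R¹_{1,n+1})] = (1/n) E[f]·E[ψ(R¹_{1,2})] + (1/n) ∑_{l=2}^n E[f·ψ(R¹_{1,l})]`
(replicas are indexed from `0` here, so `R¹_{1,l}` is `R1 ω 0 (l-1)`). -/
def GG1 (μ : Measure OA) : Prop :=
  ∀ n : ℕ, 1 ≤ n →
  ∀ f : ((Fin n → Fin n → ℝ) × (Fin n → Fin n → ℝ) × (Fin n → Fin n → ℝ)) → ℝ,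
    Measurable f → (∃ C, ∀ v, |f v| ≤ C) →
  ∀ ψ : ℝ → ℝ, Measurable ψ → (∃ C, ∀ x, |ψ x| ≤ C) → (∀ x, ψ (-x) = ψ x) →
    ∫ ω, fRep n f ω * ψ (R1 ω 0 n) ∂μ
      = (1 / n) * (∫ ω, fRep n f ω ∂μ) * (∫ ω, ψ (R1 ω 0 1) ∂μ)
        + (1 / n) * ∑ l ∈ Finset.Ico 1 n, ∫ ω, fRep n f ω * ψ (R1 ω 0 l) ∂μ

/-- The Ghirlanda–Guerra identities for system 2. -/
def GG2 (μ : Measure OA) : Prop :=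
  ∀ n : ℕ, 1 ≤ n →
  ∀ f : ((Fin n → Fin n → ℝ) × (Fin n → Fin n → ℝ) × (Fin n → Fin n → ℝ)) → ℝ,
    Measurable f → (∃ C, ∀ v, |f v| ≤ C) →
  ∀ ψ : ℝ → ℝ, Measurable ψ → (∃ C, ∀ x, |ψ x| ≤ C) → (∀ x, ψ (-x) = ψ x) →
    ∫ ω, fRep n f ω * ψ (R2 ω 0 n) ∂μ
      = (1 / n) * (∫ ω, fRep n f ω ∂μ) * (∫ ω, ψ (R2 ω 0 1) ∂μ)
        + (1 / n) * ∑ l ∈ Finset.Ico 1 n, ∫ ω, fRep n f ω * ψ (R2 ω 0 l) ∂μ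

/-- The event `{R_{1,1} ∈ A}`. -/
def EA (A : Set ℝ) : Set OA := {ω | R ω 0 0 ∈ A}

/-- The event `{|R¹_{l,l'}| ∈ A₁ for all l ≠ l' ≤ n}` (with `0`-based replica indices). -/
def E1 (n : ℕ) (A1 : Set ℝ) : Set OA :=
  {ω | ∀ l l', l < n → l' < n → l ≠ l' → |R1 ω l l'| ∈ A1}

/-- The event `{|R²_{l,l'}| ∈ A₂ for all l ≠ l' ≤ n}` (with `0`-based replica indices). -/
def E2 (n : ℕ) (A2 : Set ℝ) : Set OA :=
  {ω | ∀ l l', l < n → l' < n → l ≠ l' → |R2 ω l l'| ∈ A2}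

/-- The event `B_n`. -/
def Bev (n : ℕ) (A A1 A2 : Set ℝ) : Set OA := EA A ∩ E1 n A1 ∩ E2 n A2

/-- The event `C_n`. -/
def Cev (n : ℕ) (A A1 A2 : Set ℝ) : Set OA := EA A ∩ E1 (n + 1) A1 ∩ E2 n A2

end OverlapArray

namespace OverlapArray

/-- The Ψ-identities for system 1 with function `ψ`: for every `n ≥ 1` and every bounded
measurable function `f` of the overlaps on `n` replicas,
`E[f·ψ(R_{1,n+1})] = (1/n) ∑_{l=1}^n E[f·ψ(R_{1,l})]`
(replicas are indexed from `0` here). -/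
def Psi1Id (μ : MeasureTheory.Measure OA) (ψ : ℝ → ℝ) : Prop :=
  ∀ n : ℕ, 1 ≤ n →
  ∀ f : ((Fin n → Fin n → ℝ) × (Fin n → Fin n → ℝ) × (Fin n → Fin n → ℝ)) → ℝ,
    Measurable f → (∃ C, ∀ v, |f v| ≤ C) →
    ∫ ω, fRep n f ω * ψ (R ω 0 n) ∂μ
      = (1 / n) * ∑ l ∈ Finset.range n, ∫ ω, fRep n f ω * ψ (R ω 0 l) ∂μ

/-- The Ψ-identities for system 2 with function `ψ`: for every `n ≥ 1` and every bounded
measurable function `f` of the overlaps on `n` replicas,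
`E[f·ψ(R_{n+1,1})] = (1/n) ∑_{l=1}^n E[f·ψ(R_{l,1})]`. -/
def Psi2Id (μ : MeasureTheory.Measure OA) (ψ : ℝ → ℝ) : Prop :=
  ∀ n : ℕ, 1 ≤ n →
  ∀ f : ((Fin n → Fin n → ℝ) × (Fin n → Fin n → ℝ) × (Fin n → Fin n → ℝ)) → ℝ,
    Measurable f → (∃ C, ∀ v, |f v| ≤ C) →
    ∫ ω, fRep n f ω * ψ (R ω n 0) ∂μ
      = (1 / n) * ∑ l ∈ Finset.range n, ∫ ω, fRep n f ω * ψ (R ω l 0) ∂μ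

end OverlapArray

open OverlapArray

namespace OverlapArray

lemma measurable_R (l m : ℕ) : Measurable (fun ω : OA => R ω l m) := by
  unfold R; fun_prop

lemma measurable_permMap (π π' : Equiv.Perm ℕ) : Measurable (permMap π π') := by
  unfold permMap R1 R2 R
  fun_prop

lemma swap_finite (a b : ℕ) : {x | Equiv.swap a b x ≠ x}.Finite := by
  refine (Set.toFinite ({a, b} : Set ℕ)).subset ?_
  intro x hx
  by_contra h
  simp only [Set.mem_insert_iff, Set.mem_singleton_iff, not_or] at h
  exact hx (Equiv.swap_apply_of_ne_of_ne h.1 h.2)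

lemma id_finite : {x : ℕ | (1 : Equiv.Perm ℕ) x ≠ x}.Finite := by simp

lemma ae_pow_eq_one (μ : Measure OA) (hs : Setup μ) (p : ℕ)
    (h1 : Psi1Id μ (fun x => x ^ p)) :
    ∀ᵐ ω ∂μ, R ω 0 0 ^ p = R ω 0 1 ^ p := by
  have := hs.prob
  have hb : ∀ l m, ∀ᵐ ω ∂μ, |R ω l m ^ p| ≤ 1 := by
    intro l m
    filter_upwards [hs.bounded] with ω h
    rw [abs_pow]
    exact pow_le_one₀ (abs_nonneg _) (h l m).2.2
  have hint : ∀ l m l' m', Integrable (fun ω => R ω l m ^ p * R ω l' m' ^ p) μ := by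
    intro l m l' m'
    refine Integrable.of_bound (C := 1)
      (((measurable_R l m).pow_const p).mul ((measurable_R l' m').pow_const p)).aestronglyMeasurable ?_
    filter_upwards [hb l m, hb l' m'] with ω h h'
    rw [Real.norm_eq_abs, abs_mul]
    exact mul_le_one₀ h (abs_nonneg _) h'
  have key := h1 1 le_rfl (fun v => max (-1) (min 1 (v.2.2 0 0 ^ p))) (by fun_prop)
    ⟨1, fun v => abs_le.2 ⟨le_max_left _ _, max_le (by norm_num) (min_le_left _ _)⟩⟩
  have hf : ∀ᵐ ω ∂μ, fRep 1 (fun v => max (-1) (min 1 (v.2.2 0 0 ^ p))) ω = R ω 0 0 ^ p := by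
    filter_upwards [hb 0 0] with ω h
    have := abs_le.1 h
    simp only [fRep, Fin.val_zero]
    rw [min_eq_right this.2, max_eq_right this.1]
  have e1 : ∀ m, ∫ ω, fRep 1 (fun v => max (-1) (min 1 (v.2.2 0 0 ^ p))) ω * R ω 0 m ^ p ∂μ
      = ∫ ω, R ω 0 0 ^ p * R ω 0 m ^ p ∂μ := by
    intro m
    apply integral_congr_ae
    filter_upwards [hf] with ω h
    rw [h]
  simp only [e1, Finset.sum_range_one, Nat.cast_one, div_one, one_mul] at key
  have hex : ∫ ω, R ω 0 0 ^ p * R ω 0 0 ^ p ∂μ = ∫ ω, R ω 0 1 ^ p * R ω 0 1 ^ p ∂μ := by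
    have hm : Measurable (fun ω : OA => R ω 0 0 ^ p * R ω 0 0 ^ p) :=
      ((measurable_R 0 0).pow_const p).mul ((measurable_R 0 0).pow_const p)
    conv_lhs => rw [← hs.exch 1 (Equiv.swap 0 1) id_finite (swap_finite 0 1)]
    rw [integral_map (measurable_permMap _ _).aemeasurable
      (hm.aestronglyMeasurable)]
    simp [permMap, R]
  have hz : ∫ ω, (R ω 0 0 ^ p - R ω 0 1 ^ p) ^ 2 ∂μ = 0 := by
    have : ∀ ω, (R ω 0 0 ^ p - R ω 0 1 ^ p) ^ 2 = R ω 0 0 ^ p * R ω 0 0 ^ p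
        - 2 * (R ω 0 0 ^ p * R ω 0 1 ^ p) + R ω 0 1 ^ p * R ω 0 1 ^ p := fun ω => by ring
    simp_rw [this]
    have hsub : Integrable (fun ω => R ω 0 0 ^ p * R ω 0 0 ^ p
        - 2 * (R ω 0 0 ^ p * R ω 0 1 ^ p)) μ := (hint 0 0 0 0).sub ((hint 0 0 0 1).const_mul 2)
    rw [integral_add hsub (hint 0 1 0 1),
      integral_sub (hint 0 0 0 0) ((hint 0 0 0 1).const_mul 2), integral_const_mul]
    linarith
  have hi : Integrable (fun ω => (R ω 0 0 ^ p - R ω 0 1 ^ p) ^ 2) μ := by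
    have : (fun ω => (R ω 0 0 ^ p - R ω 0 1 ^ p) ^ 2) = fun ω => R ω 0 0 ^ p * R ω 0 0 ^ p
        - 2 * (R ω 0 0 ^ p * R ω 0 1 ^ p) + R ω 0 1 ^ p * R ω 0 1 ^ p := by
      funext ω; ring
    rw [this]
    exact ((hint 0 0 0 0).sub ((hint 0 0 0 1).const_mul 2)).add (hint 0 1 0 1)
  rw [integral_eq_zero_iff_of_nonneg (fun ω => sq_nonneg _) hi] at hz
  filter_upwards [hz] with ω h
  exact sub_eq_zero.1 (pow_eq_zero_iff (two_ne_zero)|>.1 h)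

lemma ae_pow_eq (μ : Measure OA) (hs : Setup μ) (p : ℕ)
    (h1 : Psi1Id μ (fun x => x ^ p)) (m : ℕ) :
    ∀ᵐ ω ∂μ, R ω 0 m ^ p = R ω 0 0 ^ p := by
  rcases Nat.eq_zero_or_pos m with rfl | hm
  · exact Filter.Eventually.of_forall fun _ => rfl
  have h := ae_pow_eq_one μ hs p h1
  rw [← hs.exch 1 (Equiv.swap 1 m) id_finite (swap_finite 1 m)] at h
  have h' := ae_of_ae_map (measurable_permMap _ _).aemeasurable h
  filter_upwards [h'] with ω hω
  have h0 : Equiv.swap 1 m 0 = 0 := Equiv.swap_apply_of_ne_of_ne (by omega) (by omega)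
  simp only [permMap, R, Equiv.Perm.one_apply, h0, Equiv.swap_apply_left] at hω
  exact hω.symm

lemma psi_of_ae (μ : Measure OA) (ψ : ℝ → ℝ)
    (h : ∀ m, ∀ᵐ ω ∂μ, ψ (R ω 0 m) = ψ (R ω 0 0)) : Psi1Id μ ψ := by
  intro n hn f _ _
  have e : ∀ m, ∫ ω, fRep n f ω * ψ (R ω 0 m) ∂μ = ∫ ω, fRep n f ω * ψ (R ω 0 0) ∂μ := by
    intro m
    apply integral_congr_ae
    filter_upwards [h m] with ω hω
    rw [hω]
  have hn' : (n : ℝ) ≠ 0 := by positivity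
  rw [e n, Finset.sum_congr rfl (fun l _ => e l), Finset.sum_const, Finset.card_range, nsmul_eq_mul]
  field_simp

end OverlapArray

/-- In the overlap array setup, suppose `μ` satisfies the Ψ-identities for
system 1 with `ψ(x) = x^p` for some `p ≥ 1`. If `p` is even then `μ` satisfies the
Ψ-identities for system 1 with every even continuous `ψ : [-1,1] → ℝ`; if `p` is odd then
with every continuous `ψ : [-1,1] → ℝ`. -/
theorem statement_17 (μ : MeasureTheory.Measure OA) (hsetup : Setup μ)
    (p : ℕ) (hp : 1 ≤ p) (h1 : Psi1Id μ (fun x => x ^ p)) :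
    (Even p → ∀ ψ : ℝ → ℝ, Continuous ψ → (∀ x, ψ (-x) = ψ x) → Psi1Id μ ψ) ∧
    (Odd p → ∀ ψ : ℝ → ℝ, Continuous ψ → Psi1Id μ ψ) := by
  have hp0 : p ≠ 0 := by omega
  constructor
  · intro hev ψ _ hψ
    refine psi_of_ae μ ψ fun m => ?_
    filter_upwards [ae_pow_eq μ hsetup p h1 m] with ω h
    rcases (pow_eq_pow_iff_of_ne_zero hp0).1 h with h | ⟨h, -⟩
    · rw [h]
    · rw [h, hψ]
  · intro hodd ψ _
    refine psi_of_ae μ ψ fun m => ?_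
    filter_upwards [ae_pow_eq μ hsetup p h1 m] with ω h
    rw [hodd.strictMono_pow.injective h]
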